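/- ε-machines are minimally stochastic: if η is a prescient effective-state function whose rival state variables have finite entropy, then the one-step state uncertainty of the rival machine is at least that of the ε-machine: H[η(Past_1) | η(Past_0)] ≥ H[S_1 | S_0], where Past_1(ω) = (ω_0, ω_{−1}, ω_{−2}, …) is the past at time 1. -/

import Mathlib

open MeasureTheory ProbabilityTheory

noncomputable section

/-- Shannon entropy (in bits) of a random variable `U`. -/
def ent {Ω S : Type*} [MeasurableSpace Ω] (μ : Measure Ω) (U : Ω → S) : ℝ :=
  ∑' s : S, -((μ (U ⁻¹' {s})).toReal * Real.logb 2 (μ (U ⁻¹' {s})).toReal)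

/-- The entropy series of `U` is summable (i.e. `U` has finite entropy). -/
def entSummable {Ω S : Type*} [MeasurableSpace Ω] (μ : Measure Ω) (U : Ω → S) : Prop :=
  Summable (fun s : S => -((μ (U ⁻¹' {s})).toReal * Real.logb 2 (μ (U ⁻¹' {s})).toReal))

/-- Conditional Shannon entropy (in bits) H[U|V]. -/
def condEnt {Ω S T : Type*} [MeasurableSpace Ω] (μ : Measure Ω) (U : Ω → S) (V : Ω → T) : ℝ :=
  ent μ (fun ω => (U ω, V ω)) - ent μ V

/-- Mutual information (in bits) I[U;V]. -/
def mutInf {Ω S T : Type*} [MeasurableSpace Ω] (μ : Measure Ω) (U : Ω → S) (V : Ω → T) : ℝ :=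
  ent μ U + ent μ V - ent μ (fun ω => (U ω, V ω))

variable (A : Type*) [Fintype A] [MeasurableSpace A] [MeasurableSingletonClass A]

/-- The left shift on bi-infinite sequences. -/
def shift : (ℤ → A) → (ℤ → A) := fun ω t => ω (t + 1)

/-- The infinite future `(ω_0, ω_1, …)`. -/
def Future : (ℤ → A) → (ℕ → A) := fun ω n => ω (n : ℤ)

/-- The length-`L` future block `(X_0, …, X_{L-1})`. -/
def FutureBlk (L : ℕ) : (ℤ → A) → (Fin L → A) := fun ω i => ω ((i : ℕ) : ℤ)

/-- The length-`M` past block `(X_{-M}, …, X_{-1})`. -/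
def PastBlk (M : ℕ) : (ℤ → A) → (Fin M → A) := fun ω i => ω (((i : ℕ) : ℤ) - (M : ℤ))

/-- The infinite past at time `t`: `(ω_{t-1}, ω_{t-2}, …)`. -/
def PastAt (t : ℤ) : (ℤ → A) → (ℕ → A) := fun ω n => ω (t - 1 - (n : ℤ))

/-- The infinite past at time `0`. -/
abbrev Past : (ℤ → A) → (ℕ → A) := PastAt A 0

/-- `H[Future^L | Past] := inf_{M ≥ 1} H[Future^L | Past^M]`. -/
def condEntPast (μ : Measure (ℤ → A)) (L : ℕ) : ℝ :=
  ⨅ M : ℕ, condEnt μ (FutureBlk A L) (PastBlk A (M + 1))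

variable [Nontrivial A]

/-- The causal state at time `t`: the regular conditional distribution of the
future given the past, evaluated on the past at time `t`. -/
def causalState (μ : Measure (ℤ → A)) [IsFiniteMeasure μ] (t : ℤ) :
    (ℤ → A) → Measure (ℕ → A) :=
  fun ω => condDistrib (Future A) (Past A) μ (PastAt A t ω)

end

noncomputable section

/-- An effective-state function `η` is prescient if conditioning on the rival state
`η(Past)` predicts every future block as well as the full infinite past. -/
def Prescient {A : Type*} [Fintype A] [MeasurableSpace A] [MeasurableSingletonClass A]
    {R : Type*} (μ : Measure (ℤ → A)) (η : (ℕ → A) → R) : Prop :=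
  ∀ L : ℕ, 1 ≤ L →
    condEnt μ (FutureBlk A L) (fun ω => η (Past A ω)) = condEntPast A μ L

end


section Discrete

lemma norm_negMulLog_le_one {x : ℝ} (h0 : 0 ≤ x) (h1 : x ≤ 1) : ‖Real.negMulLog x‖ ≤ 1 := by
  rw [Real.norm_of_nonneg (Real.negMulLog_nonneg h0 h1)]
  exact (Real.negMulLog_le_one_sub_self h0).trans (sub_le_self _ h0)

variable {Ω S T : Type*} {U : Ω → S} {V : Ω → T}

lemma preimage_pair_singleton (U : Ω → S) (V : Ω → T) (x : S × T) :
    (fun ω => (U ω, V ω)) ⁻¹' {x} = U ⁻¹' {x.1} ∩ V ⁻¹' {x.2} := by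
  ext ω
  simp [Prod.ext_iff]

lemma countable_range_pair (hU : (Set.range U).Countable) (hV : (Set.range V).Countable) :
    (Set.range fun ω => (U ω, V ω)).Countable :=
  (hU.prod hV).mono (by rintro _ ⟨ω, rfl⟩; exact ⟨⟨ω, rfl⟩, ⟨ω, rfl⟩⟩)

lemma preimage_eq_empty_of_notMem_range {s : S} (hs : s ∉ Set.range U) : U ⁻¹' {s} = ∅ := by
  rw [Set.preimage_singleton_eq_empty]
  exact hs

variable [MeasurableSpace Ω] {μ : Measure Ω}

lemma measureReal_pos_of_ne_zero [IsFiniteMeasure μ] {s : Set Ω} (h : μ s ≠ 0) : 0 < μ.real s :=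
  ENNReal.toReal_pos h (measure_ne_top _ _)

lemma measurableSet_preimage_pair (hU : ∀ s, MeasurableSet (U ⁻¹' {s}))
    (hV : ∀ t, MeasurableSet (V ⁻¹' {t})) (x : S × T) :
    MeasurableSet ((fun ω => (U ω, V ω)) ⁻¹' {x}) := by
  rw [preimage_pair_singleton]
  exact (hU _).inter (hV _)

lemma measurable_rangeFactorization_top (hc : (Set.range U).Countable)
    (hU : ∀ s, MeasurableSet (U ⁻¹' {s})) :
    Measurable[_, ⊤] (Set.rangeFactorization U) := by
  have := hc.to_subtype
  refine @measurable_to_countable' _ _ ⊤ _ _ _ fun d => ?_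
  convert hU d using 1
  ext ω
  simp [Set.rangeFactorization, Subtype.ext_iff]

lemma integrable_comp_iff_summable [IsFiniteMeasure μ] (hc : (Set.range U).Countable)
    (hU : ∀ s, MeasurableSet (U ⁻¹' {s})) (f : S → ℝ) :
    Integrable (fun ω => f (U ω)) μ ↔ Summable fun s => μ.real (U ⁻¹' {s}) * f s := by
  have := hc.to_subtype
  let : MeasurableSpace (Set.range U) := ⊤
  have hm : Measurable (Set.rangeFactorization U) := measurable_rangeFactorization_top hc hU
  have hpre (d : Set.range U) : Set.rangeFactorization U ⁻¹' {d} = U ⁻¹' {(d : S)} := by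
    ext ω
    simp [Set.rangeFactorization, Subtype.ext_iff]
  have h1 : Integrable (fun ω => f (U ω)) μ ↔
      Integrable (fun d : Set.range U => f d) (μ.map (Set.rangeFactorization U)) := by
    rw [integrable_map_measure (measurable_from_top.aestronglyMeasurable) hm.aemeasurable]
    rfl
  have h2 : (Summable fun s => μ.real (U ⁻¹' {s}) * f s) ↔
      Summable fun d : Set.range U => μ.real (U ⁻¹' {(d : S)}) * f d := by
    refine (Function.Injective.summable_iff Subtype.val_injective fun s hs => ?_).symm
    rw [Subtype.range_coe] at hs
    simp [preimage_eq_empty_of_notMem_range hs]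
  rw [h1, h2, ← summable_abs_iff]
  have h3 : Integrable (fun d : Set.range U => f d) (μ.map (Set.rangeFactorization U)) ↔
      (∑' d : Set.range U, ENNReal.ofReal |μ.real (U ⁻¹' {(d : S)}) * f d|) ≠ ⊤ := by
    rw [Integrable, and_iff_right measurable_from_top.aestronglyMeasurable, HasFiniteIntegral,
      lintegral_countable', ← lt_top_iff_ne_top]
    refine iff_of_eq (congrArg (· < ⊤) (tsum_congr fun d => ?_))
    rw [Measure.map_apply hm trivial, hpre, abs_mul, abs_of_nonneg measureReal_nonneg,
      ENNReal.ofReal_mul measureReal_nonneg, mul_comm, ofReal_measureReal,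
      ← Real.norm_eq_abs, ofReal_norm]
  rw [h3]
  constructor
  · intro h
    simpa using ENNReal.summable_toReal h
  · intro h
    rw [← ENNReal.ofReal_tsum_of_nonneg (fun _ => abs_nonneg _) h]
    exact ENNReal.ofReal_ne_top

lemma integral_comp_eq_tsum [IsFiniteMeasure μ] (hc : (Set.range U).Countable)
    (hU : ∀ s, MeasurableSet (U ⁻¹' {s})) {f : S → ℝ} (hf : Integrable (fun ω => f (U ω)) μ) :
    ∫ ω, f (U ω) ∂μ = ∑' s, μ.real (U ⁻¹' {s}) * f s := by
  have := hc.to_subtype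
  let : MeasurableSpace (Set.range U) := ⊤
  have hm : Measurable (Set.rangeFactorization U) := measurable_rangeFactorization_top hc hU
  have hpre (d : Set.range U) : Set.rangeFactorization U ⁻¹' {d} = U ⁻¹' {(d : S)} := by
    ext ω
    simp [Set.rangeFactorization, Subtype.ext_iff]
  have h1 : Integrable (fun d : Set.range U => f d) (μ.map (Set.rangeFactorization U)) := by
    rw [integrable_map_measure (measurable_from_top.aestronglyMeasurable) hm.aemeasurable]
    exact hf
  have h2 : ∫ ω, f (U ω) ∂μ = ∫ d : Set.range U, f d ∂(μ.map (Set.rangeFactorization U)) := by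
    rw [integral_map hm.aemeasurable measurable_from_top.aestronglyMeasurable]
    rfl
  rw [h2, integral_countable h1, ← tsum_subtype_eq_of_support_subset (s := Set.range U)]
  · refine tsum_congr fun d => ?_
    rw [map_measureReal_apply hm trivial, hpre, smul_eq_mul]
  · intro s hs
    by_contra hs'
    simp [preimage_eq_empty_of_notMem_range hs'] at hs

lemma ae_measure_fiber_ne_zero (hc : (Set.range U).Countable) :
    ∀ᵐ ω ∂μ, μ (U ⁻¹' {U ω}) ≠ 0 := by
  have h : ∀ᵐ ω ∂μ, ∀ s ∈ Set.range U, μ (U ⁻¹' {s}) = 0 → U ω ≠ s := by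
    refine (ae_ball_iff hc).2 fun s _ => ?_
    by_cases h0 : μ (U ⁻¹' {s}) = 0
    · filter_upwards [compl_mem_ae_iff.2 h0] with ω hω _ using hω
    · simp [h0]
  filter_upwards [h] with ω hω h0 using hω _ ⟨ω, rfl⟩ h0 rfl

/-- The information content (in bits) of the observed value of `U`. -/
noncomputable def surprisal (μ : Measure Ω) (U : Ω → S) (ω : Ω) : ℝ :=
  -Real.logb 2 (μ.real (U ⁻¹' {U ω}))

lemma surprisal_nonneg [IsProbabilityMeasure μ] (U : Ω → S) (ω : Ω) : 0 ≤ surprisal μ U ω :=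
  neg_nonneg.2 (Real.logb_nonpos one_lt_two measureReal_nonneg measureReal_le_one)

lemma entSummable_iff_integrable [IsFiniteMeasure μ] (hc : (Set.range U).Countable)
    (hU : ∀ s, MeasurableSet (U ⁻¹' {s})) :
    entSummable μ U ↔ Integrable (surprisal μ U) μ := by
  refine Iff.trans (iff_of_eq ?_) (integrable_comp_iff_summable hc hU
    fun s => -Real.logb 2 (μ.real (U ⁻¹' {s}))).symm
  simp only [entSummable, mul_neg, measureReal_def]

lemma ent_eq_integral [IsFiniteMeasure μ] (hc : (Set.range U).Countable)
    (hU : ∀ s, MeasurableSet (U ⁻¹' {s})) (hi : Integrable (surprisal μ U) μ) :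
    ent μ U = ∫ ω, surprisal μ U ω ∂μ := by
  refine Eq.trans ?_ (integral_comp_eq_tsum hc hU
    (f := fun s => -Real.logb 2 (μ.real (U ⁻¹' {s}))) hi).symm
  simp only [ent, mul_neg, measureReal_def]

lemma aestronglyMeasurable_comp (hc : (Set.range U).Countable)
    (hU : ∀ s, MeasurableSet (U ⁻¹' {s})) (f : S → ℝ) :
    AEStronglyMeasurable (fun ω => f (U ω)) μ := by
  have := hc.to_subtype
  let : MeasurableSpace (Set.range U) := ⊤
  have hm : Measurable (Set.rangeFactorization U) := measurable_rangeFactorization_top hc hU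
  exact ((measurable_from_top (f := fun d : Set.range U => f d)).comp hm).aestronglyMeasurable

lemma summable_measureReal_fiber [IsFiniteMeasure μ] (hc : (Set.range U).Countable)
    (hU : ∀ s, MeasurableSet (U ⁻¹' {s})) : Summable fun s => μ.real (U ⁻¹' {s}) := by
  simpa using (integrable_comp_iff_summable hc hU fun _ => (1 : ℝ)).1 (integrable_const _)

/-- Subadditivity of entropy, in the form of finiteness of the joint entropy. -/
lemma integrable_surprisal_pair [IsProbabilityMeasure μ]
    (hcU : (Set.range U).Countable) (hU : ∀ s, MeasurableSet (U ⁻¹' {s}))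
    (hcV : (Set.range V).Countable) (hV : ∀ t, MeasurableSet (V ⁻¹' {t}))
    (hiU : Integrable (surprisal μ U) μ) (hiV : Integrable (surprisal μ V) μ) :
    Integrable (surprisal μ fun ω => (U ω, V ω)) μ := by
  set W : Ω → S × T := fun ω => (U ω, V ω) with hW
  have hcW := countable_range_pair hcU hcV
  have hWm := measurableSet_preimage_pair hU hV
  have hratio : Integrable (fun ω => (fun x : S × T =>
      μ.real (U ⁻¹' {x.1}) * μ.real (V ⁻¹' {x.2}) / μ.real (W ⁻¹' {x})) (W ω)) μ := by
    refine (integrable_comp_iff_summable (μ := μ) (U := W) hcW hWm fun x : S × T =>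
      μ.real (U ⁻¹' {x.1}) * μ.real (V ⁻¹' {x.2}) / μ.real (W ⁻¹' {x})).2 ?_
    refine Summable.of_nonneg_of_le (fun x => by positivity) (fun x => ?_)
      ((summable_measureReal_fiber (μ := μ) hcU hU).mul_of_nonneg
        (summable_measureReal_fiber (μ := μ) hcV hV)
        (fun _ => measureReal_nonneg) (fun _ => measureReal_nonneg))
    by_cases h : μ.real (W ⁻¹' {x}) = 0
    · rw [h]
      simp only [zero_mul]
      positivity
    · rw [mul_div_cancel₀ _ h]
  refine ((hiU.add hiV).add (hratio.div_const (Real.log 2))).mono'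
    (aestronglyMeasurable_comp hcW hWm fun x => -Real.logb 2 (μ.real (W ⁻¹' {x}))) ?_
  filter_upwards [ae_measure_fiber_ne_zero (μ := μ) hcW] with ω hω
  have hw : 0 < μ.real (W ⁻¹' {W ω}) := measureReal_pos_of_ne_zero hω
  have hle := preimage_pair_singleton U V (W ω)
  have hu : 0 < μ.real (U ⁻¹' {U ω}) :=
    hw.trans_le (measureReal_mono (hle.le.trans Set.inter_subset_left))
  have hv : 0 < μ.real (V ⁻¹' {V ω}) :=
    hw.trans_le (measureReal_mono (hle.le.trans Set.inter_subset_right))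
  rw [Real.norm_of_nonneg (surprisal_nonneg _ _)]
  simp only [surprisal, Pi.add_apply, Real.logb, ← neg_div, ← add_div]
  refine div_le_div_of_nonneg_right ?_ (Real.log_pos one_lt_two).le
  have h := Real.log_le_sub_one_of_pos (div_pos (mul_pos hu hv) hw)
  rw [Real.log_div (by positivity) hw.ne', Real.log_mul hu.ne' hv.ne'] at h
  simp only [hW] at h ⊢
  linarith

lemma condEnt_eq_integral [IsProbabilityMeasure μ]
    (hcU : (Set.range U).Countable) (hU : ∀ s, MeasurableSet (U ⁻¹' {s}))
    (hcV : (Set.range V).Countable) (hV : ∀ t, MeasurableSet (V ⁻¹' {t}))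
    (hiUV : Integrable (surprisal μ fun ω => (U ω, V ω)) μ) (hiV : Integrable (surprisal μ V) μ) :
    condEnt μ U V = ∫ ω, (surprisal μ (fun ω => (U ω, V ω)) ω - surprisal μ V ω) ∂μ := by
  rw [condEnt, ent_eq_integral (countable_range_pair hcU hcV) (measurableSet_preimage_pair hU hV)
    hiUV, ent_eq_integral hcV hV hiV, integral_sub hiUV hiV]

/-- Pointwise comparison of conditional probabilities compares conditional entropies. -/
lemma condEnt_le_condEnt_of_ae_div_le [IsProbabilityMeasure μ] {S' T' : Type*}
    {U' : Ω → S'} {V' : Ω → T'}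
    (hcU : (Set.range U).Countable) (hU : ∀ s, MeasurableSet (U ⁻¹' {s}))
    (hcV : (Set.range V).Countable) (hV : ∀ t, MeasurableSet (V ⁻¹' {t}))
    (hcU' : (Set.range U').Countable) (hU' : ∀ s, MeasurableSet (U' ⁻¹' {s}))
    (hcV' : (Set.range V').Countable) (hV' : ∀ t, MeasurableSet (V' ⁻¹' {t}))
    (hiU : Integrable (surprisal μ U) μ) (hiV : Integrable (surprisal μ V) μ)
    (hiU' : Integrable (surprisal μ U') μ) (hiV' : Integrable (surprisal μ V') μ)
    (hle : ∀ᵐ ω ∂μ, μ.real (U' ⁻¹' {U' ω} ∩ V' ⁻¹' {V' ω}) / μ.real (V' ⁻¹' {V' ω}) ≤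
      μ.real (U ⁻¹' {U ω} ∩ V ⁻¹' {V ω}) / μ.real (V ⁻¹' {V ω})) :
    condEnt μ U V ≤ condEnt μ U' V' := by
  have hp := integrable_surprisal_pair hcU hU hcV hV hiU hiV
  have hp' := integrable_surprisal_pair hcU' hU' hcV' hV' hiU' hiV'
  rw [condEnt_eq_integral hcU hU hcV hV hp hiV, condEnt_eq_integral hcU' hU' hcV' hV' hp' hiV']
  refine integral_mono_ae (hp.sub hiV) (hp'.sub hiV') ?_
  filter_upwards [hle, ae_measure_fiber_ne_zero (μ := μ) (countable_range_pair hcU hcV),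
    ae_measure_fiber_ne_zero (μ := μ) (countable_range_pair hcU' hcV')] with ω h h1 h2
  simp only [preimage_pair_singleton] at h1 h2
  have key {a b c d : ℝ} (ha : 0 < a) (hb : 0 < b) (hc : 0 < c) (hd : 0 < d)
      (h : a / b ≤ c / d) : -Real.logb 2 c - -Real.logb 2 d ≤ -Real.logb 2 a - -Real.logb 2 b := by
    have := Real.logb_le_logb_of_le one_lt_two (by positivity) h
    rw [Real.logb_div ha.ne' hb.ne', Real.logb_div hc.ne' hd.ne'] at this
    linarith
  simp only [surprisal, preimage_pair_singleton]
  exact key (measureReal_pos_of_ne_zero h2) ((measureReal_pos_of_ne_zero h2).trans_le (measureReal_mono Set.inter_subset_right)) (measureReal_pos_of_ne_zero h1)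
    ((measureReal_pos_of_ne_zero h1).trans_le (measureReal_mono Set.inter_subset_right)) h

/-- Conditional entropy of a finite-valued variable as the mean of `negMulLog` of the conditional
probabilities. -/
lemma condEnt_eq_sum_integral_negMulLog [IsProbabilityMeasure μ] [Fintype S]
    (hU : ∀ s, MeasurableSet (U ⁻¹' {s}))
    (hcV : (Set.range V).Countable) (hV : ∀ t, MeasurableSet (V ⁻¹' {t}))
    (hiV : Integrable (surprisal μ V) μ) :
    condEnt μ U V = (∑ s, ∫ ω, Real.negMulLog
      (μ.real (U ⁻¹' {s} ∩ V ⁻¹' {V ω}) / μ.real (V ⁻¹' {V ω})) ∂μ) / Real.log 2 := by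
  have hcU : (Set.range U).Countable := Set.to_countable _
  have hiU : Integrable (surprisal μ U) μ :=
    (entSummable_iff_integrable hcU hU).1 ⟨_, hasSum_fintype _⟩
  have hcW := countable_range_pair hcU hcV
  have hWm := measurableSet_preimage_pair hU hV
  have hp := integrable_surprisal_pair hcU hU hcV hV hiU hiV
  have hq (s : S) (t : T) : 0 ≤ μ.real (U ⁻¹' {s} ∩ V ⁻¹' {t}) / μ.real (V ⁻¹' {t}) ∧
      μ.real (U ⁻¹' {s} ∩ V ⁻¹' {t}) / μ.real (V ⁻¹' {t}) ≤ 1 :=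
    ⟨by positivity, div_le_one_of_le₀ (measureReal_mono Set.inter_subset_right) measureReal_nonneg⟩
  set q : S × T → ℝ := fun x => μ.real (U ⁻¹' {x.1} ∩ V ⁻¹' {x.2}) / μ.real (V ⁻¹' {x.2}) with hqdef
  have hae : (fun ω => surprisal μ (fun ω => (U ω, V ω)) ω - surprisal μ V ω) =ᵐ[μ]
      fun ω => (fun x => -Real.log (q x) / Real.log 2) (U ω, V ω) := by
    filter_upwards [ae_measure_fiber_ne_zero (μ := μ) hcW] with ω h
    simp only [preimage_pair_singleton] at h
    have h1 : 0 < μ.real (U ⁻¹' {U ω} ∩ V ⁻¹' {V ω}) := measureReal_pos_of_ne_zero h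
    have h2 := h1.trans_le (measureReal_mono Set.inter_subset_right)
    simp only [surprisal, preimage_pair_singleton, hqdef, Real.log_div h1.ne' h2.ne', Real.logb]
    ring
  have hint : Integrable (fun ω => (fun x => -Real.log (q x) / Real.log 2) (U ω, V ω)) μ :=
    (hp.sub hiV).congr hae
  rw [condEnt_eq_integral hcU hU hcV hV hp hiV, integral_congr_ae hae,
    integral_comp_eq_tsum (U := fun ω => (U ω, V ω)) (f := fun x => -Real.log (q x) / Real.log 2)
      hcW hWm hint,
    ((integrable_comp_iff_summable hcW hWm _).1 hint).tsum_prod, tsum_fintype, Finset.sum_div]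
  refine Finset.sum_congr rfl fun s _ => ?_
  have hb : Integrable (fun ω => (fun t => Real.negMulLog (q (s, t))) (V ω)) μ := by
    refine (integrable_const (1 : ℝ)).mono'
      (aestronglyMeasurable_comp hcV hV fun t => Real.negMulLog (q (s, t))) (ae_of_all _ ?_)
    intro ω
    exact norm_negMulLog_le_one (hq s _).1 (hq s _).2
  refine Eq.trans ?_ (congrArg (· / Real.log 2) (integral_comp_eq_tsum
    (f := fun t => Real.negMulLog (q (s, t))) hcV hV hb).symm)
  rw [← tsum_div_const]
  refine tsum_congr fun t => ?_
  rw [preimage_pair_singleton, Real.negMulLog]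
  by_cases h0 : μ.real (V ⁻¹' {t}) = 0
  · have : μ.real (U ⁻¹' {s} ∩ V ⁻¹' {t}) = 0 :=
      le_antisymm ((measureReal_mono Set.inter_subset_right).trans h0.le) measureReal_nonneg
    simp [this, h0]
  · have : μ.real (U ⁻¹' {s} ∩ V ⁻¹' {t}) = μ.real (V ⁻¹' {t}) * q (s, t) := by
      simp only [hqdef]
      field_simp
    simp only [this]
    ring

end Discrete

section Conditioning

variable {Ω β Z : Type*} [MeasurableSpace Ω] [MeasurableSpace β] [MeasurableSpace Z]
  [StandardBorelSpace Z] [Nonempty Z] {μ : Measure Ω} [IsFiniteMeasure μ] {X : Ω → β} {Y : Ω → Z}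

lemma measure_inter_eq_mul_of_condDistrib_eq (hX : Measurable X) (hY : Measurable Y)
    {E : Set β} (hE : MeasurableSet E) {s : Measure Z}
    (hs : ∀ p ∈ E, condDistrib Y X μ p = s) {B : Set Z} (hB : MeasurableSet B) :
    μ (X ⁻¹' E ∩ Y ⁻¹' B) = s B * μ (X ⁻¹' E) := by
  rw [← setLIntegral_preimage_condDistrib hX hY.aemeasurable hB hE,
    setLIntegral_congr_fun (g := fun _ => s B) (hX hE) fun ω hω => by rw [hs _ hω],
    setLIntegral_const]

lemma setIntegral_condDistrib_real (hX : Measurable X) (hY : Measurable Y)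
    {E : Set β} (hE : MeasurableSet E) {B : Set Z} (hB : MeasurableSet B) :
    ∫ ω in X ⁻¹' E, (condDistrib Y X μ (X ω)).real B ∂μ = μ.real (X ⁻¹' E ∩ Y ⁻¹' B) := by
  rw [measureReal_def, ← setLIntegral_preimage_condDistrib hX hY.aemeasurable hB hE,
    ← integral_toReal]
  · rfl
  · exact (((condDistrib Y X μ).measurable_coe hB).comp hX).aemeasurable
  · exact ae_of_all _ fun ω => measure_lt_top _ _

/-- For a countable-valued conditioning variable, conditional expectations of indicators are
elementary conditional probabilities. -/
lemma ae_div_eq_condExp {S : Type*} [Countable S] [Nonempty S] [MeasurableSpace S]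
    [MeasurableSingletonClass S] [Countable β] [MeasurableSingletonClass β] {U : Ω → S}
    (hU : Measurable U) (hX : Measurable X) (s : S) :
    (fun ω => μ.real (U ⁻¹' {s} ∩ X ⁻¹' {X ω}) / μ.real (X ⁻¹' {X ω})) =ᵐ[μ]
      μ[(U ⁻¹' {s}).indicator fun _ => (1 : ℝ) | MeasurableSpace.comap X inferInstance] := by
  refine Filter.EventuallyEq.trans ?_ (condDistrib_ae_eq_condExp hX hU (measurableSet_singleton s))
  filter_upwards [ae_measure_fiber_ne_zero (μ := μ) (U := X) (Set.to_countable _)] with ω hω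
  have hmap : (μ.map X) {X ω} = μ (X ⁻¹' {X ω}) :=
    Measure.map_apply hX (measurableSet_singleton _)
  have hpre : (fun a => (X a, U a)) ⁻¹' ({X ω} ×ˢ {s}) = U ⁻¹' {s} ∩ X ⁻¹' {X ω} := by
    ext
    simp [and_comm]
  rw [measureReal_def (condDistrib U X μ (X ω)),
    condDistrib_apply_of_ne_zero hU _ (by rwa [hmap]), hmap,
    Measure.map_apply (hX.prodMk hU) ((measurableSet_singleton _).prod (measurableSet_singleton _)),
    hpre, ENNReal.toReal_mul, ENNReal.toReal_inv, ← measureReal_def, ← measureReal_def,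
    div_eq_inv_mul]

/-- The Jensen inequality for `negMulLog` on a finite measure, with its equality case. -/
lemma integral_negMulLog_le_and_eq_imp {ν : Measure Ω} [IsFiniteMeasure ν] {f : Ω → ℝ}
    (hf : Measurable f) (h0 : ∀ ω, 0 ≤ f ω) (h1 : ∀ ω, f ω ≤ 1) :
    ∫ ω, Real.negMulLog (f ω) ∂ν ≤ ν.real Set.univ * Real.negMulLog (⨍ ω, f ω ∂ν) ∧
    (∫ ω, Real.negMulLog (f ω) ∂ν = ν.real Set.univ * Real.negMulLog (⨍ ω, f ω ∂ν) →
      ∀ᵐ ω ∂ν, f ω = ⨍ ω, f ω ∂ν) := by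
  rcases eq_or_ne ν 0 with rfl | hν
  · simp
  have : NeZero ν := ⟨hν⟩
  have hpos : 0 < ν.real Set.univ := measureReal_pos_of_ne_zero (by simpa using hν)
  have hfi : Integrable f ν := (integrable_const (1 : ℝ)).mono' hf.aestronglyMeasurable
    (ae_of_all _ fun ω => by rw [Real.norm_of_nonneg (h0 ω)]; exact h1 ω)
  have hgi : Integrable (Real.negMulLog ∘ f) ν := (integrable_const (1 : ℝ)).mono'
    (Real.continuous_negMulLog.measurable.comp hf).aestronglyMeasurable
    (ae_of_all _ fun ω => norm_negMulLog_le_one (h0 ω) (h1 ω))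
  have havg : ∫ ω, Real.negMulLog (f ω) ∂ν = ν.real Set.univ * ⨍ ω, Real.negMulLog (f ω) ∂ν := by
    rw [average_eq, smul_eq_mul, mul_inv_cancel_left₀ hpos.ne']
  rw [havg]
  refine ⟨mul_le_mul_of_nonneg_left (Real.concaveOn_negMulLog.le_map_average
    Real.continuous_negMulLog.continuousOn isClosed_Ici (ae_of_all _ h0) hfi hgi) hpos.le,
    fun heq => ?_⟩
  rcases Real.strictConcaveOn_negMulLog.ae_eq_const_or_lt_map_average
    Real.continuous_negMulLog.continuousOn isClosed_Ici (ae_of_all _ h0) hfi hgi with h | h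
  · exact h
  · exact absurd (mul_left_cancel₀ hpos.ne' heq) h.ne

end Conditioning

section Sequences

variable {A : Type*}

/-- The initial block of length `L` of a sequence. -/
def initialBlock (L : ℕ) (f : ℕ → A) : Fin L → A := fun i => f i

/-- The sequence with its first symbol deleted. -/
def tail (f : ℕ → A) : ℕ → A := fun n => f (n + 1)

/-- The sequence with a symbol prepended. -/
def prepend (a : A) (f : ℕ → A) : ℕ → A := fun n => n.casesOn a f

lemma prepend_zero_tail (f : ℕ → A) : prepend (f 0) (tail f) = f := by
  funext n
  cases n <;> rfl

variable [MeasurableSpace A]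

lemma measurable_initialBlock (L : ℕ) : Measurable (initialBlock (A := A) L) :=
  measurable_pi_lambda _ fun _ => measurable_pi_apply _

lemma measurable_tail : Measurable (tail (A := A)) :=
  measurable_pi_lambda _ fun _ => measurable_pi_apply _

lemma measurable_prepend (a : A) : Measurable (prepend a) := by
  refine measurable_pi_lambda _ fun n => ?_
  cases n with
  | zero => exact measurable_const
  | succ n => exact measurable_pi_apply n

/-- The law of the remaining sequence under `s`, given that the first symbol is `a`. -/
noncomputable def successorState (s : Measure (ℕ → A)) (a : A) : Measure (ℕ → A) :=
  (ProbabilityTheory.cond s ((fun f => f 0) ⁻¹' {a})).map tail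

instance (s : Measure (ℕ → A)) (a : A) : IsFiniteMeasure (successorState s a) := by
  unfold successorState
  infer_instance

variable [MeasurableSingletonClass A]

lemma measurableSet_initialBlock_fiber (L : ℕ) (c : Fin L → A) :
    MeasurableSet (initialBlock L ⁻¹' {c}) :=
  measurable_initialBlock L (measurableSet_singleton c)

lemma measurableSet_first_eq (a : A) : MeasurableSet ((fun f : ℕ → A => f 0) ⁻¹' {a}) :=
  measurable_pi_apply 0 (measurableSet_singleton a)

lemma successorState_apply (s : Measure (ℕ → A)) (a : A) {B : Set (ℕ → A)}
    (hB : MeasurableSet B) :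
    successorState s a B = (s ((fun f => f 0) ⁻¹' {a}))⁻¹ * s (((fun f => f 0) ⁻¹' {a}) ∩ tail ⁻¹' B) := by
  rw [successorState, Measure.map_apply measurable_tail hB,
    ProbabilityTheory.cond_apply (measurableSet_first_eq a)]

variable [Fintype A]

lemma measure_ext_of_initialBlock {ν₁ ν₂ : Measure (ℕ → A)} [IsFiniteMeasure ν₁]
    (h : ∀ L c, ν₁ (initialBlock (L + 1) ⁻¹' {c}) = ν₂ (initialBlock (L + 1) ⁻¹' {c})) :
    ν₁ = ν₂ := by
  have hmap (L : ℕ) : ν₁.map (initialBlock (L + 1)) = ν₂.map (initialBlock (L + 1)) := by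
    refine Measure.ext_iff_singleton.2 fun c => ?_
    simp only [Measure.map_apply (measurable_initialBlock _) (measurableSet_singleton c), h]
  refine IsProjectiveLimit.unique (P := fun I => ν₁.map I.restrict) (fun I => rfl) fun I => ?_
  obtain ⟨L, hL⟩ := I.exists_nat_subset_range
  let g : (Fin (L + 1) → A) → (I → A) := fun v i =>
    v ⟨i, (Finset.mem_range.1 (hL i.2)).trans (Nat.lt_succ_self L)⟩
  have hg : Measurable g := measurable_pi_lambda _ fun i => measurable_pi_apply _
  have hcomp : I.restrict = g ∘ initialBlock (A := A) (L + 1) := rfl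
  change ν₂.map I.restrict = ν₁.map I.restrict
  rw [hcomp, ← Measure.map_map hg (measurable_initialBlock _), ← hmap,
    Measure.map_map hg (measurable_initialBlock _)]

lemma measurableSet_kernel_eq {X : Type*} [MeasurableSpace X] (κ : Kernel X (ℕ → A))
    [IsFiniteKernel κ] (s : Measure (ℕ → A)) : MeasurableSet (κ ⁻¹' {s}) := by
  have hset : κ ⁻¹' {s} = ⋂ (L : ℕ) (c : Fin (L + 1) → A),
      (fun p => κ p (initialBlock (L + 1) ⁻¹' {c})) ⁻¹'
        {s (initialBlock (L + 1) ⁻¹' {c})} := by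
    ext p
    simp only [Set.mem_iInter, Set.mem_preimage, Set.mem_singleton_iff]
    exact ⟨fun h _ _ => by rw [h], fun h => measure_ext_of_initialBlock h⟩
  rw [hset]
  exact MeasurableSet.iInter fun L => MeasurableSet.iInter fun c =>
    κ.measurable_coe (measurableSet_initialBlock_fiber _ c) (measurableSet_singleton _)

end Sequences

section CausalStates

variable {A : Type*}

lemma pastAt_shift (ω : ℤ → A) : PastAt A 0 (shift A ω) = PastAt A 1 ω := by
  funext n
  exact congrArg ω (by ring)

lemma future_shift (ω : ℤ → A) : Future A (shift A ω) = tail (Future A ω) := by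
  funext n
  exact congrArg ω (by push_cast; ring)

lemma pastAt_one_eq_prepend (ω : ℤ → A) :
    PastAt A 1 ω = prepend (Future A ω 0) (PastAt A 0 ω) := by
  rw [← prepend_zero_tail (PastAt A 1 ω)]
  congr 1
  funext n
  exact congrArg ω (by push_cast; ring)

variable [MeasurableSpace A]

lemma measurable_pastAt (t : ℤ) : Measurable (PastAt A t) :=
  measurable_pi_lambda _ fun _ => measurable_pi_apply _

lemma measurable_future : Measurable (Future A) :=
  measurable_pi_lambda _ fun _ => measurable_pi_apply _

lemma measurable_pastBlk (M : ℕ) : Measurable (PastBlk A M) :=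
  measurable_pi_lambda _ fun _ => measurable_pi_apply _

lemma measurable_futureBlk (L : ℕ) : Measurable (FutureBlk A L) :=
  measurable_pi_lambda _ fun _ => measurable_pi_apply _

lemma measurable_shift : Measurable (shift A) :=
  measurable_pi_lambda _ fun _ => measurable_pi_apply _

/-- The filtration generated by the growing finite pasts. -/
def pastFiltration (A : Type*) [MeasurableSpace A] :
    Filtration ℕ (inferInstance : MeasurableSpace (ℤ → A)) where
  seq M := MeasurableSpace.comap (PastBlk A (M + 1)) inferInstance
  mono' := by
    refine monotone_nat_of_le_succ fun M => ?_
    let g : (Fin (M + 1 + 1) → A) → (Fin (M + 1) → A) := fun v i => v i.succ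
    have hg : Measurable g := measurable_pi_lambda _ fun i => measurable_pi_apply _
    have hcomp : PastBlk A (M + 1) = g ∘ PastBlk A (M + 1 + 1) := by
      funext ω i
      exact congrArg ω (by push_cast [Fin.val_succ]; ring)
    rw [hcomp, ← MeasurableSpace.comap_comp]
    exact MeasurableSpace.comap_mono hg.comap_le
  le' M := (measurable_pastBlk _).comap_le

lemma iSup_pastFiltration :
    ⨆ M, pastFiltration A M = MeasurableSpace.comap (PastAt A 0) inferInstance := by
  refine le_antisymm (iSup_le fun M => ?_) ?_
  · let g : (ℕ → A) → (Fin (M + 1) → A) := fun f i => f (M - i)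
    have hg : Measurable g := measurable_pi_lambda _ fun i => measurable_pi_apply _
    have hcomp : PastBlk A (M + 1) = g ∘ PastAt A 0 := by
      funext ω i
      exact congrArg ω (by push_cast [Nat.cast_sub (Nat.lt_succ_iff.1 i.2)]; ring)
    change MeasurableSpace.comap (PastBlk A (M + 1)) inferInstance ≤ _
    rw [hcomp, ← MeasurableSpace.comap_comp]
    exact MeasurableSpace.comap_mono hg.comap_le
  · refine Measurable.comap_le ?_
    refine @measurable_pi_lambda _ _ _ (_) _ _ fun n => ?_
    have hn : Measurable[pastFiltration A n] (PastBlk A (n + 1)) := comap_measurable _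
    have hle : pastFiltration A n ≤ ⨆ M, pastFiltration A M := le_iSup (pastFiltration A ·) n
    have hcomp : (fun ω : ℤ → A => PastAt A 0 ω n) = (fun v => v 0) ∘ PastBlk A (n + 1) := by
      funext ω
      exact congrArg ω (by push_cast [Fin.val_zero]; ring)
    rw [hcomp]
    exact (measurable_pi_apply 0).comp (hn.mono hle le_rfl)

variable [Fintype A] [Nontrivial A] [MeasurableSingletonClass A]
  {μ : Measure (ℤ → A)} [IsProbabilityMeasure μ]

lemma causalState_one (ω : ℤ → A) :
    causalState A μ 1 ω = causalState A μ 0 (shift A ω) := by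
  simp only [causalState, pastAt_shift]

lemma measurableSet_causalState_fiber (t : ℤ) (s : Measure (ℕ → A)) :
    MeasurableSet (causalState A μ t ⁻¹' {s}) :=
  measurable_pastAt t (measurableSet_kernel_eq (condDistrib (Future A) (Past A) μ) s)

/-- Unifilarity: the next causal state is determined by the current one and the next symbol. -/
lemma ae_causalState_one_eq_successorState (hstat : μ.map (shift A) = μ)
    (hcount : (Set.range (causalState A μ 0)).Countable) :
    ∀ᵐ ω ∂μ, causalState A μ 1 ω = successorState (causalState A μ 0 ω) (Future A ω 0) := by
  set κ := condDistrib (Future A) (Past A) μ with hκ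
  have hP : Measurable (Past A) := measurable_pastAt 0
  have hF : Measurable (Future A) := measurable_future
  have hpush (E B : Set (ℕ → A)) (hE : MeasurableSet E) (hB : MeasurableSet B) :
      μ (Past A ⁻¹' E ∩ Future A ⁻¹' B) = μ (PastAt A 1 ⁻¹' E ∩ Future A ⁻¹' (tail ⁻¹' B)) := by
    conv_lhs => rw [← hstat, Measure.map_apply measurable_shift ((hP hE).inter (hF hB))]
    congr 1
    ext ω
    simp [pastAt_shift, future_shift]
  have hmap1 : μ.map (PastAt A 1) = μ.map (Past A) := by
    conv_rhs => rw [← hstat, Measure.map_map hP measurable_shift]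
    congr 1
    funext ω
    exact (pastAt_shift ω).symm
  have key (s : Measure (ℕ → A)) (a : A) (L : ℕ) (c : Fin (L + 1) → A) :
      ∀ᵐ ω ∂μ, causalState A μ 0 ω = s → Future A ω 0 = a →
        causalState A μ 1 ω (initialBlock (L + 1) ⁻¹' {c}) =
          successorState s a (initialBlock (L + 1) ⁻¹' {c}) := by
    set B : Set (ℕ → A) := initialBlock (L + 1) ⁻¹' {c} with hB
    have hBm : MeasurableSet B := measurableSet_initialBlock_fiber _ c
    set D : Set (ℕ → A) := tail ⁻¹' (κ ⁻¹' {s}) ∩ (fun f => f 0) ⁻¹' {a} with hD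
    have hDm : MeasurableSet D :=
      (measurable_tail (measurableSet_kernel_eq κ s)).inter (measurableSet_first_eq a)
    have hae : (fun p => κ p B) =ᵐ[(μ.map (Past A)).restrict D] fun _ => successorState s a B := by
      refine ae_eq_of_forall_setLIntegral_eq_of_sigmaFinite (κ.measurable_coe hBm)
        measurable_const fun E hE _ => ?_
      rw [Measure.restrict_restrict hE, setLIntegral_const, successorState_apply s a hBm,
        Measure.restrict_map hP (hE.inter hDm), lintegral_map (κ.measurable_coe hBm) hP,
        setLIntegral_preimage_condDistrib hP hF.aemeasurable hBm (hE.inter hDm),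
        ← hmap1, Measure.map_apply (measurable_pastAt 1) (hE.inter hDm),
        hpush _ _ (hE.inter hDm) hBm]
      set E' : Set (ℕ → A) := κ ⁻¹' {s} ∩ prepend a ⁻¹' E with hE'
      have hE'm : MeasurableSet E' :=
        (measurableSet_kernel_eq κ s).inter (measurable_prepend a hE)
      have hs : ∀ p ∈ E', κ p = s := fun p hp => hp.1
      have hpre : PastAt A 1 ⁻¹' (E ∩ D) =
          Past A ⁻¹' E' ∩ Future A ⁻¹' ((fun f => f 0) ⁻¹' {a}) := by
        ext ω
        simp only [hE', hD, Set.mem_preimage, Set.mem_inter_iff, pastAt_one_eq_prepend,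
          Set.mem_singleton_iff]
        constructor
        · rintro ⟨h1, h2, h3⟩
          have h4 : Future A ω 0 = a := h3
          rw [h4] at h1
          exact ⟨⟨h2, h1⟩, h4⟩
        · rintro ⟨⟨h1, h2⟩, h3⟩
          rw [h3]
          exact ⟨h2, h1, rfl⟩
      rw [hpre, Set.inter_assoc, ← Set.preimage_inter,
        measure_inter_eq_mul_of_condDistrib_eq hP hF hE'm hs
          ((measurableSet_first_eq a).inter (measurable_tail hBm)),
        measure_inter_eq_mul_of_condDistrib_eq hP hF hE'm hs (measurableSet_first_eq a)]
      rcases (E').eq_empty_or_nonempty with h | ⟨p, hp⟩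
      · simp [h]
      have : IsProbabilityMeasure s := by
        rw [← hs p hp]
        infer_instance
      by_cases h0 : s ((fun f => f 0) ⁻¹' {a}) = 0
      · rw [h0, measure_mono_null Set.inter_subset_left h0]
        simp
      · rw [← one_mul (s _ * μ _), ← ENNReal.mul_inv_cancel h0 (measure_ne_top s _)]
        ring
    have hae' := (ae_restrict_iff' hDm).1 hae
    rw [← hmap1] at hae'
    filter_upwards [ae_of_ae_map (measurable_pastAt 1).aemeasurable hae'] with ω hω h0 h1
    refine hω ⟨?_, ?_⟩
    · rw [pastAt_one_eq_prepend]
      exact h0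
    · rw [pastAt_one_eq_prepend]
      exact h1
  have hall : ∀ᵐ ω ∂μ, ∀ s ∈ Set.range (causalState A μ 0), ∀ a L, ∀ c : Fin (L + 1) → A,
      causalState A μ 0 ω = s → Future A ω 0 = a →
        causalState A μ 1 ω (initialBlock (L + 1) ⁻¹' {c}) =
          successorState s a (initialBlock (L + 1) ⁻¹' {c}) :=
    (ae_ball_iff hcount).2 fun s _ =>
      ae_all_iff.2 fun a => ae_all_iff.2 fun L => ae_all_iff.2 fun c => key s a L c
  filter_upwards [hall] with ω hω
  have : IsFiniteMeasure (causalState A μ 1 ω) := by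
    unfold causalState
    infer_instance
  exact measure_ext_of_initialBlock fun L c => hω _ ⟨ω, rfl⟩ _ L c rfl rfl

end CausalStates

section Prescience

variable {A : Type*} [Fintype A] [Nontrivial A] [MeasurableSpace A] [MeasurableSingletonClass A]
  {μ : Measure (ℤ → A)} [IsProbabilityMeasure μ]

lemma condEnt_pastBlk_eq (L M : ℕ) :
    condEnt μ (FutureBlk A L) (PastBlk A (M + 1)) = (∑ c : Fin L → A, ∫ ω, Real.negMulLog
      ((μ[(FutureBlk A L ⁻¹' {c}).indicator fun _ => (1 : ℝ) | pastFiltration A M]) ω) ∂μ) /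
        Real.log 2 := by
  have hV := measurable_pastBlk (A := A) (M + 1)
  have hF := measurable_futureBlk (A := A) L
  have hVs (t) : MeasurableSet (PastBlk A (M + 1) ⁻¹' {t}) := hV (measurableSet_singleton t)
  rw [condEnt_eq_sum_integral_negMulLog (fun c => hF (measurableSet_singleton c))
    (Set.to_countable _) hVs
    ((entSummable_iff_integrable (Set.to_countable _) hVs).1 ⟨_, hasSum_fintype _⟩)]
  congr 1
  refine Finset.sum_congr rfl fun c _ => integral_congr_ae ?_
  filter_upwards [ae_div_eq_condExp (μ := μ) hF hV c] with ω hω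
  rw [hω]
  rfl

lemma condExp_indicator_mem_Icc {Ω : Type*} {m : MeasurableSpace Ω} [mΩ : MeasurableSpace Ω]
    {ν : Measure Ω}
    [IsFiniteMeasure ν] {E : Set Ω}
    (hE : MeasurableSet E) :
    ∀ᵐ ω ∂ν, (ν[E.indicator fun _ => (1 : ℝ) | m]) ω ∈ Set.Icc 0 1 := by
  by_cases hm : m ≤ mΩ
  · have hi : Integrable (E.indicator fun _ => (1 : ℝ)) ν := (integrable_const _).indicator hE
    have h0 := condExp_nonneg (m := m) (μ := ν) (f := E.indicator fun _ => (1 : ℝ))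
      (ae_of_all _ fun ω => Set.indicator_nonneg (fun _ _ => zero_le_one) ω)
    have h1 := condExp_mono (m := m) (μ := ν) hi (integrable_const (1 : ℝ))
      (ae_of_all _ fun ω => Set.indicator_le_self' (fun _ _ => zero_le_one) ω)
    rw [condExp_const hm] at h1
    filter_upwards [h0, h1] with ω a b using ⟨a, b⟩
  · simp [condExp_of_not_le hm]

/-- The conditional entropy of a future block given the infinite past is bounded by its expression
through the causal states. -/
lemma condEntPast_le (L : ℕ) :
    condEntPast A μ L ≤ (∑ c : Fin L → A, ∫ ω, Real.negMulLog
      ((causalState A μ 0 ω).real (initialBlock L ⁻¹' {c})) ∂μ) / Real.log 2 := by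
  have hlog : 0 ≤ Real.log 2 := (Real.log_pos one_lt_two).le
  have hFm (c : Fin L → A) : MeasurableSet (FutureBlk A L ⁻¹' {c}) :=
    measurable_futureBlk L (measurableSet_singleton c)
  have hbdd : BddBelow (Set.range fun M => condEnt μ (FutureBlk A L) (PastBlk A (M + 1))) := by
    refine ⟨0, ?_⟩
    rintro _ ⟨M, rfl⟩
    simp only [condEnt_pastBlk_eq]
    refine div_nonneg (Finset.sum_nonneg fun c _ => integral_nonneg_of_ae ?_) hlog
    filter_upwards [condExp_indicator_mem_Icc (ν := μ) (m := pastFiltration A M) (hFm c)] with ω h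
    exact Real.negMulLog_nonneg h.1 h.2
  refine ge_of_tendsto' (x := Filter.atTop) ?_ fun M => ciInf_le hbdd M
  simp only [condEnt_pastBlk_eq]
  refine (tendsto_finsetSum _ fun c _ => ?_).div_const _
  refine tendsto_integral_of_dominated_convergence (fun _ => 1) (fun M => ?_)
    (integrable_const _) (fun M => ?_) ?_
  · exact Real.continuous_negMulLog.comp_aestronglyMeasurable
      integrable_condExp.aestronglyMeasurable
  · filter_upwards [condExp_indicator_mem_Icc (ν := μ) (m := pastFiltration A M) (hFm c)] with ω h
    exact norm_negMulLog_le_one h.1 h.2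
  · have hlim := condDistrib_ae_eq_condExp (μ := μ) (measurable_pastAt (A := A) 0)
      measurable_future (measurableSet_initialBlock_fiber L c)
    filter_upwards [tendsto_ae_condExp (μ := μ) (ℱ := pastFiltration A)
      ((FutureBlk A L ⁻¹' {c}).indicator fun _ => (1 : ℝ)), hlim] with ω h1 h2
    rw [iSup_pastFiltration] at h1
    refine (Real.continuous_negMulLog.tendsto _).comp ?_
    change Filter.Tendsto _ _ (nhds ((condDistrib (Future A) (Past A) μ (PastAt A 0 ω)).real _))
    rw [h2]
    exact h1

/-- A prescient state function refines the causal states, up to a null set. -/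
lemma Prescient.exists_ae_causalState_eq {R : Type*} [Countable R] [MeasurableSpace R]
    [MeasurableSingletonClass R] {η : (ℕ → A) → R} (hpresc : Prescient μ η) (hη : Measurable η)
    (hfin : entSummable μ fun ω => η (PastAt A 0 ω)) {r : R}
    (hr : μ ((fun ω => η (PastAt A 0 ω)) ⁻¹' {r}) ≠ 0) :
    ∃ s, ∀ᵐ ω ∂μ, η (PastAt A 0 ω) = r → causalState A μ 0 ω = s := by
  set V : (ℤ → A) → R := fun ω => η (PastAt A 0 ω) with hVdef
  have hP := measurable_pastAt (A := A) 0
  have hV : Measurable V := hη.comp hP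
  have hVs (t : R) : MeasurableSet (V ⁻¹' {t}) := hV (measurableSet_singleton t)
  set f : (L : ℕ) → (Fin L → A) → (ℤ → A) → ℝ := fun L c ω =>
    (causalState A μ 0 ω).real (initialBlock L ⁻¹' {c}) with hf
  have hprob (ω) : IsProbabilityMeasure (causalState A μ 0 ω) := by
    unfold causalState
    infer_instance
  have hfm (L c) : Measurable (f L c) :=
    (((condDistrib (Future A) (Past A) μ).measurable_coe
      (measurableSet_initialBlock_fiber L c)).comp hP).ennreal_toReal
  have hf0 (L c ω) : 0 ≤ f L c ω := measureReal_nonneg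
  have hf1 (L c ω) : f L c ω ≤ 1 := measureReal_le_one
  set q : (L : ℕ) → (Fin L → A) → R → ℝ := fun L c t =>
    μ.real (FutureBlk A L ⁻¹' {c} ∩ V ⁻¹' {t}) / μ.real (V ⁻¹' {t}) with hq
  have hq0 (L c t) : 0 ≤ q L c t := by positivity
  have hq1 (L c t) : q L c t ≤ 1 :=
    div_le_one_of_le₀ (measureReal_mono Set.inter_subset_right) measureReal_nonneg
  have havg (L c) (t : R) : ⨍ ω in V ⁻¹' {t}, f L c ω ∂μ = q L c t := by
    rw [setAverage_eq, smul_eq_mul, ← div_eq_inv_mul]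
    refine congrArg (· / _) ((setIntegral_condDistrib_real hP measurable_future
      (hη (measurableSet_singleton t)) (measurableSet_initialBlock_fiber L c)).trans ?_)
    rw [Set.inter_comm]
    rfl
  have hgint (L c) : Integrable (fun ω => Real.negMulLog (q L c (V ω))) μ :=
    (integrable_const (1 : ℝ)).mono'
      (aestronglyMeasurable_comp (Set.to_countable _) hVs fun t => Real.negMulLog (q L c t))
      (ae_of_all _ fun ω => norm_negMulLog_le_one (hq0 _ _ _) (hq1 _ _ _))
  have hfint (L c) : Integrable (fun ω => Real.negMulLog (f L c ω)) μ :=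
    (integrable_const (1 : ℝ)).mono'
      (Real.continuous_negMulLog.measurable.comp (hfm L c)).aestronglyMeasurable
      (ae_of_all _ fun ω => norm_negMulLog_le_one (hf0 _ _ _) (hf1 _ _ _))
  have hgset (L c) (t : R) : ∫ ω in V ⁻¹' {t}, Real.negMulLog (q L c (V ω)) ∂μ =
      μ.real (V ⁻¹' {t}) * Real.negMulLog (q L c t) := by
    rw [setIntegral_congr_fun (g := fun _ => Real.negMulLog (q L c t)) (hVs t)
      fun ω hω => by rw [show V ω = t from hω], setIntegral_const, smul_eq_mul]
  have hJ (L c) (t : R) := integral_negMulLog_le_and_eq_imp (ν := μ.restrict (V ⁻¹' {t}))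
    (hfm L c) (hf0 L c) (hf1 L c)
  simp only [havg, measureReal_restrict_apply_univ] at hJ
  set gap : (L : ℕ) → (Fin L → A) → R → ℝ := fun L c t => ∫ ω in V ⁻¹' {t},
    (Real.negMulLog (q L c (V ω)) - Real.negMulLog (f L c ω)) ∂μ with hgap
  have hgap_eq (L c t) : gap L c t = μ.real (V ⁻¹' {t}) * Real.negMulLog (q L c t) -
      ∫ ω in V ⁻¹' {t}, Real.negMulLog (f L c ω) ∂μ := by
    rw [← hgset]
    exact integral_sub (hgint L c).integrableOn (hfint L c).integrableOn
  have hgap0 (L c t) : 0 ≤ gap L c t := by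
    rw [hgap_eq]
    exact sub_nonneg.2 (hJ L c t).1
  have hsum (L c) : HasSum (gap L c)
      (∫ ω, (Real.negMulLog (q L c (V ω)) - Real.negMulLog (f L c ω)) ∂μ) := by
    have h := hasSum_integral_iUnion (μ := μ) (s := fun t : R => V ⁻¹' {t})
      (f := fun ω => Real.negMulLog (q L c (V ω)) - Real.negMulLog (f L c ω)) hVs
      (fun a b hab => (Set.disjoint_singleton.2 hab).preimage V)
      ((hgint L c).sub (hfint L c)).integrableOn
    have huniv : ⋃ t : R, V ⁻¹' {t} = Set.univ := by
      ext ω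
      simp
    rwa [huniv, setIntegral_univ] at h
  have hzero (L : ℕ) (c : Fin (L + 1) → A) : gap (L + 1) c r = 0 := by
    have hle := (hpresc (L + 1) (Nat.succ_pos L)).le.trans (condEntPast_le (μ := μ) (L + 1))
    rw [condEnt_eq_sum_integral_negMulLog
      (fun c => measurable_futureBlk _ (measurableSet_singleton c)) (Set.to_countable _) hVs
      ((entSummable_iff_integrable (Set.to_countable _) hVs).1 hfin),
      div_le_div_iff_of_pos_right (Real.log_pos one_lt_two), ← sub_nonpos,
      ← Finset.sum_sub_distrib] at hle
    have hle' : ∑ c, ∫ ω, (Real.negMulLog (q (L + 1) c (V ω)) -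
        Real.negMulLog (f (L + 1) c ω)) ∂μ ≤ 0 := by
      refine le_trans (le_of_eq (Finset.sum_congr rfl fun c _ => ?_)) hle
      exact integral_sub (hgint _ c) (hfint _ c)
    have hnn (c : Fin (L + 1) → A) : 0 ≤ ∫ ω, (Real.negMulLog (q (L + 1) c (V ω)) -
        Real.negMulLog (f (L + 1) c ω)) ∂μ := (hsum _ c).nonneg (hgap0 _ c)
    have h0 := (Finset.sum_eq_zero_iff_of_nonneg fun c _ => hnn c).1
      (le_antisymm hle' (Finset.sum_nonneg fun c _ => hnn c)) c (Finset.mem_univ c)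
    have hs := hsum (L + 1) c
    rw [h0] at hs
    exact congrFun ((hasSum_zero_iff_of_nonneg (hgap0 _ c)).1 hs) r
  have hconst : ∀ᵐ ω ∂μ.restrict (V ⁻¹' {r}), ∀ L, ∀ c : Fin (L + 1) → A,
      f (L + 1) c ω = q (L + 1) c r := by
    refine ae_all_iff.2 fun L => ae_all_iff.2 fun c => (hJ (L + 1) c r).2 ?_
    have h := hzero L c
    rw [hgap_eq] at h
    linarith
  have hne : (ae (μ.restrict (V ⁻¹' {r}))).NeBot := by
    rw [ae_neBot]
    exact fun h => hr (by simpa using congrArg (· Set.univ) h)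
  obtain ⟨ω₀, h₀⟩ := hconst.exists
  refine ⟨causalState A μ 0 ω₀, ?_⟩
  filter_upwards [(ae_restrict_iff' (hVs r)).1 hconst] with ω hω hr'
  refine measure_ext_of_initialBlock fun L c => ?_
  exact (measureReal_eq_measureReal_iff).1 ((hω hr' L c).trans (h₀ L c).symm)

end Prescience

/-- Along a causal state, the joint law of a rival state, the causal state and the next causal
state factors through the causal state. -/
lemma measure_causalState_one_inter {A : Type*} [Fintype A] [Nontrivial A] [MeasurableSpace A]
    [MeasurableSingletonClass A] {μ : Measure (ℤ → A)} [IsProbabilityMeasure μ]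
    (hstat : μ.map (shift A) = μ) (hcount : (Set.range (causalState A μ 0)).Countable)
    (s s' : Measure (ℕ → A)) {E : Set (ℕ → A)} (hE : MeasurableSet E)
    (hEs : ∀ᵐ ω ∂μ, PastAt A 0 ω ∈ E → causalState A μ 0 ω = s) :
    μ (causalState A μ 1 ⁻¹' {s'} ∩ PastAt A 0 ⁻¹' E) =
      s ((fun f => f 0) ⁻¹' {a | successorState s a = s'}) * μ (PastAt A 0 ⁻¹' E) := by
  have hG : MeasurableSet ((fun f : ℕ → A => f 0) ⁻¹' {a | successorState s a = s'}) :=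
    measurable_pi_apply 0 (Set.toFinite _).measurableSet
  have hκ := measurableSet_kernel_eq (condDistrib (Future A) (Past A) μ) s
  have h1 : (PastAt A 0 ⁻¹' E : Set (ℤ → A)) =ᵐ[μ] PastAt A 0 ⁻¹'
      (E ∩ condDistrib (Future A) (Past A) μ ⁻¹' {s}) := by
    filter_upwards [hEs] with ω hω
    exact propext ⟨fun h => ⟨h, hω h⟩, fun h => h.1⟩
  have h2 : (causalState A μ 1 ⁻¹' {s'} ∩ PastAt A 0 ⁻¹' E : Set (ℤ → A)) =ᵐ[μ]
      (PastAt A 0 ⁻¹' (E ∩ condDistrib (Future A) (Past A) μ ⁻¹' {s}) ∩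
        Future A ⁻¹' ((fun f => f 0) ⁻¹' {a | successorState s a = s'}) : Set (ℤ → A)) := by
    filter_upwards [hEs, ae_causalState_one_eq_successorState hstat hcount] with ω hω hT
    refine propext ⟨fun h => ?_, fun h => ?_⟩
    · have hs := hω h.2
      rw [hs] at hT
      exact ⟨⟨h.2, hs⟩, hT.symm.trans h.1⟩
    · have hs := hω h.1.1
      rw [hs] at hT
      exact ⟨hT.trans h.2, h.1.1⟩
  rw [measure_congr h1, measure_congr h2]
  exact measure_inter_eq_mul_of_condDistrib_eq (measurable_pastAt 0) measurable_future
    (hE.inter hκ) (fun p hp => hp.2) hG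

/-- ε-machines are minimally stochastic. -/
theorem epsilon_machines_minimally_stochastic
    {A : Type*} [Fintype A] [Nontrivial A] [MeasurableSpace A] [MeasurableSingletonClass A]
    (μ : Measure (ℤ → A)) [IsProbabilityMeasure μ]
    (hstat : μ.map (shift A) = μ)
    (hcount : (Set.range (causalState A μ 0)).Countable)
    (hfin : entSummable μ (causalState A μ 0))
    {R : Type*} [Countable R] [MeasurableSpace R] [MeasurableSingletonClass R]
    (η : (ℕ → A) → R) (hη : Measurable η)
    (hpresc : Prescient μ η)
    (hfin0 : entSummable μ (fun ω => η (PastAt A 0 ω)))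
    (hfin1 : entSummable μ (fun ω => η (PastAt A 1 ω))) :
    condEnt μ (fun ω => η (PastAt A 1 ω)) (fun ω => η (PastAt A 0 ω)) ≥
      condEnt μ (causalState A μ 1) (causalState A μ 0) := by
  have hshift : MeasurePreserving (shift A) μ μ := ⟨measurable_shift, hstat⟩
  have hS1 : causalState A μ 1 = causalState A μ 0 ∘ shift A := funext causalState_one
  have hR1 : (fun ω => η (PastAt A 1 ω)) = (fun ω => η (PastAt A 0 ω)) ∘ shift A :=
    funext fun ω => congrArg η (pastAt_shift ω).symm
  have hcount1 : (Set.range (causalState A μ 1)).Countable := by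
    rw [hS1]
    exact hcount.mono (Set.range_comp_subset_range _ _)
  have hSm := measurableSet_causalState_fiber (μ := μ)
  have hRm (t : ℤ) (r : R) : MeasurableSet ((fun ω => η (PastAt A t ω)) ⁻¹' {r}) :=
    (hη.comp (measurable_pastAt t)) (measurableSet_singleton r)
  have hSfin1 : entSummable μ (causalState A μ 1) := by
    unfold entSummable at hfin ⊢
    simpa only [hS1, Set.preimage_comp, hshift.measure_preimage (hSm 0 _).nullMeasurableSet]
      using hfin
  refine condEnt_le_condEnt_of_ae_div_le hcount1 (hSm 1) hcount (hSm 0) (Set.to_countable _)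
    (hRm 1) (Set.to_countable _) (hRm 0)
    ((entSummable_iff_integrable hcount1 (hSm 1)).1 hSfin1)
    ((entSummable_iff_integrable hcount (hSm 0)).1 hfin)
    ((entSummable_iff_integrable (Set.to_countable _) (hRm 1)).1 hfin1)
    ((entSummable_iff_integrable (Set.to_countable _) (hRm 0)).1 hfin0) ?_
  have href : ∀ᵐ ω ∂μ, ∀ᵐ ω' ∂μ,
      η (PastAt A 0 ω') = η (PastAt A 0 ω) → causalState A μ 0 ω' = causalState A μ 0 ω := by
    have hall : ∀ᵐ ω ∂μ, ∀ r, ∀ s,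
        (∀ᵐ ω' ∂μ, η (PastAt A 0 ω') = r → causalState A μ 0 ω' = s) →
          μ ((fun ω => η (PastAt A 0 ω)) ⁻¹' {r}) ≠ 0 →
            η (PastAt A 0 ω) = r → causalState A μ 0 ω = s := by
      refine ae_all_iff.2 fun r => ?_
      by_cases hr : μ ((fun ω => η (PastAt A 0 ω)) ⁻¹' {r}) = 0
      · simp [hr]
      obtain ⟨s₀, hs₀⟩ := hpresc.exists_ae_causalState_eq hη hfin0 hr
      have hpos : ∃ᵐ ω ∂μ, η (PastAt A 0 ω) = r := frequently_ae_iff.2 hr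
      filter_upwards [hs₀] with ω hω s hs _ hr'
      obtain ⟨ω', h1, h2, h3⟩ := (hpos.and_eventually (hs₀.and hs)).exists
      rw [hω hr', ← h2 h1, h3 h1]
    filter_upwards [hall, ae_measure_fiber_ne_zero (μ := μ)
      (U := fun ω => η (PastAt A 0 ω)) (Set.to_countable _)] with ω hω hpos
    obtain ⟨s, hs⟩ := hpresc.exists_ae_causalState_eq hη hfin0 hpos
    filter_upwards [hs] with ω' h1 h2
    rw [h1 h2, hω _ s hs hpos rfl]
  have href1 : ∀ᵐ ω ∂μ, ∀ᵐ ω' ∂μ,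
      η (PastAt A 1 ω') = η (PastAt A 1 ω) → causalState A μ 1 ω' = causalState A μ 1 ω := by
    filter_upwards [hshift.quasiMeasurePreserving.ae href] with ω hω
    filter_upwards [hshift.quasiMeasurePreserving.ae hω] with ω' h
    simpa only [pastAt_shift, ← causalState_one] using h
  filter_upwards [href, href1, ae_measure_fiber_ne_zero (μ := μ)
    (U := fun ω => η (PastAt A 0 ω)) (Set.to_countable _),
    ae_measure_fiber_ne_zero (μ := μ) hcount] with ω h0 h1 hR hS
  have hratioR := measure_causalState_one_inter hstat hcount (causalState A μ 0 ω)
    (causalState A μ 1 ω) (hη (measurableSet_singleton (η (PastAt A 0 ω)))) h0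
  have hratioS := measure_causalState_one_inter hstat hcount (causalState A μ 0 ω)
    (causalState A μ 1 ω)
    (measurableSet_kernel_eq (condDistrib (Future A) (Past A) μ) (causalState A μ 0 ω))
    (ae_of_all _ fun _ h => h)
  have hdiv {x y : Set (ℤ → A)} {k : ENNReal} (h : μ x = k * μ y) (hy : μ y ≠ 0) :
      μ.real x / μ.real y = k.toReal := by
    rw [measureReal_def, h, ENNReal.toReal_mul]
    exact mul_div_cancel_right₀ _ (measureReal_pos_of_ne_zero hy).ne'
  refine le_trans ?_ ((hdiv hratioR hR).trans (hdiv hratioS hS).symm).le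
  refine div_le_div_of_nonneg_right
    (ENNReal.toReal_mono (measure_ne_top _ _) (measure_mono_ae ?_)) measureReal_nonneg
  filter_upwards [h1] with ω' h
  exact fun hx => ⟨h hx.1, hx.2⟩
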